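/- arXiv:1212.5493 — 5 statements merged into one kernel-verified Lean document; each statement's English description precedes it below -/
import Mathlib

section
/- Let (Ω, F, P) be a probability space with a filtration (F_m)_{m∈ℕ}. Let (Z_m)_{m≥0} be an adapted sequence of real random variables with Z_0 = 0 and Z_{m−1} ≤ Z_m almost surely for every m ≥ 1, and set Z_∞ = lim_{m→∞} Z_m (a limit in [0,∞]). Suppose there exists a nonnegative random variable U with U < ∞ almost surely such that Σ_{m=1}^∞ E[Z_m − Z_{m−1} | F_{m−1}] ≤ U almost surely. Then for every ε ∈ (0,1), P{Z_∞ > ε} ≤ ((1+ε)/ε) · E[min(U,1)]. -/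
open MeasureTheory Filter
open scoped ENNReal

/-- If `(Z m)` is an adapted, a.s. nondecreasing sequence of real random variables with
`Z 0 = 0`, and `g (m+1)` is the `[0,∞]`-valued conditional expectation of the nonnegative
increment `Z (m+1) - Z m` given `ℱ m`, and `∑ₘ g (m+1) ≤ U` a.s. for an a.s. finite
nonnegative random variable `U`, then for `ε ∈ (0,1)`,
`P {Z∞ > ε} ≤ ((1+ε)/ε) · E[min (U, 1)]`, where `Z∞ = lim Z m = ⨆ m, Z m`. -/
theorem stmt0
    {Ω : Type*} {mΩ : MeasurableSpace Ω} (P : Measure Ω) [IsProbabilityMeasure P]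
    (ℱ : Filtration ℕ mΩ)
    (Z : ℕ → Ω → ℝ)
    (hadapted : Adapted ℱ Z)
    (hZ0 : ∀ ω, Z 0 ω = 0)
    (hmono : ∀ᵐ ω ∂P, Monotone fun m => Z m ω)
    (g : ℕ → Ω → ℝ≥0∞)
    (hgmeas : ∀ m : ℕ, Measurable[ℱ m] (g (m + 1)))
    (hgcond : ∀ m : ℕ, ∀ s : Set Ω, MeasurableSet[ℱ m] s →
      ∫⁻ ω in s, g (m + 1) ω ∂P = ∫⁻ ω in s, ENNReal.ofReal (Z (m + 1) ω - Z m ω) ∂P)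
    (U : Ω → ℝ≥0∞)
    (hUfin : ∀ᵐ ω ∂P, U ω < ⊤)
    (hsum : ∀ᵐ ω ∂P, (∑' m : ℕ, g (m + 1) ω) ≤ U ω)
    (ε : ℝ) (hε0 : 0 < ε) (hε1 : ε < 1) :
    P {ω | ENNReal.ofReal ε < ⨆ m, ENNReal.ofReal (Z m ω)} ≤
      ENNReal.ofReal ((1 + ε) / ε) * ∫⁻ ω, min (U ω) 1 ∂P := by
  classical
  set A : Ω → ℝ≥0∞ := fun ω => ∑' m : ℕ, g (m + 1) ω with hA
  set B : ℕ → Ω → ℝ≥0∞ := fun n ω => ∑ k ∈ Finset.range (n + 1), g (k + 1) ω with hB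
  set D : ℕ → Ω → ℝ≥0∞ := fun m ω => ENNReal.ofReal (Z (m + 1) ω - Z m ω) with hD
  set S : ℕ → Set Ω := fun n => {ω | B n ω ≤ 1} with hS
  have hBm : ∀ n, Measurable[ℱ n] (B n) := by
    intro n
    refine Finset.measurable_fun_sum _ fun k hk => ?_
    exact (hgmeas k).mono (ℱ.mono (by simp at hk; omega)) le_rfl
  have hSm : ∀ n, MeasurableSet[ℱ n] (S n) := fun n => (hBm n) measurableSet_Iic
  have hSm' : ∀ n, MeasurableSet (S n) := fun n => ℱ.le n _ (hSm n)
  have hgm : ∀ m, Measurable (g (m + 1)) := fun m => (hgmeas m).mono (ℱ.le m) le_rfl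
  have hZm : ∀ m, Measurable (Z m) := fun m => (hadapted m).mono (ℱ.le m) le_rfl
  have hDm : ∀ m, Measurable (D m) := fun m =>
    ENNReal.measurable_ofReal.comp ((hZm (m + 1)).sub (hZm m))
  have hAm : Measurable A := Measurable.ennreal_tsum hgm
  set W : Ω → ℝ≥0∞ := fun ω => ∑' m : ℕ, (S m).indicator (D m) ω with hW
  have hWm : Measurable W := Measurable.ennreal_tsum fun m => (hDm m).indicator (hSm' m)
  have hpt : ∀ ω, (∑' m : ℕ, (S m).indicator (g (m + 1)) ω) ≤ min (A ω) 1 := by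
    intro ω
    refine le_min (ENNReal.tsum_le_tsum fun m => Set.indicator_le_self _ _ _) ?_
    refine ENNReal.tsum_le_of_sum_range_le fun n => ?_
    induction n with
    | zero => simp
    | succ n ih =>
      by_cases h : ω ∈ S n
      · refine le_trans (Finset.sum_le_sum fun m _ => Set.indicator_le_self _ _ _) ?_
        exact h
      · rw [Finset.sum_range_succ, Set.indicator_of_notMem h, add_zero]
        exact ih
  have hWint : ∫⁻ ω, W ω ∂P ≤ ∫⁻ ω, min (A ω) 1 ∂P := by
    calc ∫⁻ ω, W ω ∂P = ∑' m : ℕ, ∫⁻ ω, (S m).indicator (D m) ω ∂P :=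
          lintegral_tsum fun m => ((hDm m).indicator (hSm' m)).aemeasurable
      _ = ∑' m : ℕ, ∫⁻ ω, (S m).indicator (g (m + 1)) ω ∂P := by
          refine tsum_congr fun m => ?_
          rw [lintegral_indicator (hSm' m), lintegral_indicator (hSm' m)]
          exact (hgcond m (S m) (hSm m)).symm
      _ = ∫⁻ ω, ∑' m : ℕ, (S m).indicator (g (m + 1)) ω ∂P :=
          (lintegral_tsum fun m => ((hgm m).indicator (hSm' m)).aemeasurable).symm
      _ ≤ _ := lintegral_mono hpt
  have hZW : ∀ ω, A ω ≤ 1 → (⨆ m, ENNReal.ofReal (Z m ω)) ≤ W ω := by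
    intro ω hω
    have hin : ∀ m, ω ∈ S m := fun m => (ENNReal.sum_le_tsum _).trans hω
    have h2 : ∀ n, ENNReal.ofReal (Z n ω) ≤
        ∑ m ∈ Finset.range n, (S m).indicator (D m) ω := by
      intro n
      induction n with
      | zero => simp [hZ0]
      | succ n ih =>
        rw [Finset.sum_range_succ, Set.indicator_of_mem (hin n)]
        calc ENNReal.ofReal (Z (n + 1) ω)
            = ENNReal.ofReal (Z n ω + (Z (n + 1) ω - Z n ω)) := by congr 1; ring
          _ ≤ _ := ENNReal.ofReal_add_le
          _ ≤ _ := add_le_add ih le_rfl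
    exact iSup_le fun n => (h2 n).trans (ENNReal.sum_le_tsum _)
  have hsub : {ω | ENNReal.ofReal ε < ⨆ m, ENNReal.ofReal (Z m ω)} ⊆
      {ω | 1 ≤ min (A ω) 1} ∪ {ω | ENNReal.ofReal ε ≤ W ω} := by
    intro ω hω
    by_cases h : A ω ≤ 1
    · exact Or.inr (hω.le.trans (hZW ω h))
    · exact Or.inl (le_min (not_le.mp h).le le_rfl)
  have hε : ENNReal.ofReal ε ≠ 0 := by simpa using hε0
  have h1 : P {ω | 1 ≤ min (A ω) 1} ≤ ∫⁻ ω, min (A ω) 1 ∂P := by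
    simpa using mul_meas_ge_le_lintegral (μ := P) (hAm.min (measurable_const (a := (1 : ℝ≥0∞)))) 1
  have h2 : P {ω | ENNReal.ofReal ε ≤ W ω} ≤ ENNReal.ofReal (1 / ε) * ∫⁻ ω, min (A ω) 1 ∂P := by
    refine (meas_ge_le_lintegral_div hWm.aemeasurable hε ENNReal.ofReal_ne_top).trans ?_
    rw [one_div, ENNReal.ofReal_inv_of_pos hε0, ENNReal.div_eq_inv_mul]
    gcongr
  have h3 : ∫⁻ ω, min (A ω) 1 ∂P ≤ ∫⁻ ω, min (U ω) 1 ∂P := by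
    refine lintegral_mono_ae ?_
    filter_upwards [hsum] with ω hω
    exact min_le_min hω le_rfl
  have hc : ENNReal.ofReal ((1 + ε) / ε) = 1 + ENNReal.ofReal (1 / ε) := by
    rw [← ENNReal.ofReal_one, ← ENNReal.ofReal_add (by norm_num) (by positivity)]
    congr 1
    field_simp
    ring
  calc _ ≤ _ := measure_mono hsub
    _ ≤ _ := measure_union_le _ _
    _ ≤ _ := add_le_add h1 h2
    _ = ENNReal.ofReal ((1 + ε) / ε) * ∫⁻ ω, min (A ω) 1 ∂P := by rw [hc, add_mul, one_mul]
    _ ≤ _ := by gcongr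
end

section
/- Let (Ω, F, P) be a probability space with a filtration (F_m)_{m∈ℕ}. Let (A_m)_{m≥1} be a sequence of events with A_m ∈ F_m for every m. Suppose there exists a nonnegative random variable U with U < ∞ almost surely such that Σ_{m=1}^∞ E[1_{A_m} | F_{m−1}] ≤ U almost surely. Then P{A_m occurs for infinitely many m} = 0, and moreover P(∪_{m=1}^∞ A_m) ≤ 2 · E[min(U,1)]. -/
open MeasureTheory Filter
open scoped ENNReal

lemma aux_trunc (p : ℕ → ℝ≥0∞) :
    (∑' m, (if ∑ k ∈ Finset.range (m + 1), p k ≤ 1 then p m else 0)) ≤ min (∑' m, p m) 1 := by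
  refine le_min ?_ ?_
  · refine ENNReal.tsum_le_tsum fun m => ?_
    split_ifs <;> simp
  · refine ENNReal.tsum_le_of_sum_range_le fun n => ?_
    have : (∑ m ∈ Finset.range n, (if ∑ k ∈ Finset.range (m + 1), p k ≤ 1 then p m else 0)) ≤ 1
      ∧ (∑ m ∈ Finset.range n, (if ∑ k ∈ Finset.range (m + 1), p k ≤ 1 then p m else 0))
        ≤ ∑ k ∈ Finset.range n, p k := by
      induction n with
      | zero => simp
      | succ n ih =>
        rw [Finset.sum_range_succ]
        by_cases h : ∑ k ∈ Finset.range (n + 1), p k ≤ 1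
        · rw [if_pos h]
          have h2 := add_le_add ih.2 (le_refl (p n))
          rw [← Finset.sum_range_succ p n] at h2
          exact ⟨h2.trans h, h2⟩
        · rw [if_neg h, add_zero, Finset.sum_range_succ p n]
          exact ⟨ih.1, ih.2.trans le_self_add⟩
    exact this.1

/-- Conditional Borel–Cantelli: if `A m ∈ ℱ m` for all `m ≥ 1` and
`∑ₘ E[1_{A (m+1)} | ℱ m] ≤ U` a.s. with `U < ∞` a.s., then `P(limsup A) = 0` and
`P(⋃_{m≥1} A m) ≤ 2 E[min (U, 1)]`. -/
theorem stmt1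
    {Ω : Type*} {mΩ : MeasurableSpace Ω} (P : Measure Ω) [IsProbabilityMeasure P]
    (ℱ : Filtration ℕ mΩ)
    (A : ℕ → Set Ω)
    (hA : ∀ m : ℕ, 1 ≤ m → MeasurableSet[ℱ m] (A m))
    (U : Ω → ℝ≥0∞)
    (hUfin : ∀ᵐ ω ∂P, U ω < ⊤)
    (hsum : ∀ᵐ ω ∂P,
      (∑' m : ℕ, ENNReal.ofReal ((P[(A (m + 1)).indicator (fun _ => (1 : ℝ)) | ℱ m]) ω))
        ≤ U ω) :
    P (Filter.limsup A Filter.atTop) = 0 ∧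
      P (⋃ m : ℕ, A (m + 1)) ≤ 2 * ∫⁻ ω, min (U ω) 1 ∂P := by
  have hA' : ∀ m, MeasurableSet (A (m + 1)) := fun m => ℱ.le _ _ (hA (m + 1) (by omega))
  have hint : ∀ m, Integrable ((A (m + 1)).indicator (fun _ => (1 : ℝ))) P := fun m =>
    (integrable_const 1).indicator (hA' m)
  have hnn : ∀ᵐ ω ∂P, ∀ m, 0 ≤ (P[(A (m + 1)).indicator (fun _ => (1 : ℝ)) | ℱ m]) ω := by
    rw [ae_all_iff]
    intro m
    exact condExp_nonneg (Eventually.of_forall fun ω => Set.indicator_nonneg (by simp) ω)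
  set p : ℕ → Ω → ℝ≥0∞ := fun m ω =>
    ENNReal.ofReal ((P[(A (m + 1)).indicator (fun _ => (1 : ℝ)) | ℱ m]) ω) with hp
  constructor
  · let s : ℕ → Set Ω := fun n => if n = 0 then ∅ else A n
    have hs : ∀ n, MeasurableSet[ℱ n] (s n) := by
      intro n
      by_cases h : n = 0
      · simp [s, h]
      · simp only [s, h, if_false]; exact hA n (by omega)
    have hlim : limsup A atTop = limsup s atTop := by
      refine limsup_congr ?_
      filter_upwards [eventually_ge_atTop 1] with n hn
      simp [s, show n ≠ 0 by omega]
    have key := ae_mem_limsup_atTop_iff P hs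
    rw [hlim]
    refine measure_eq_zero_iff_ae_notMem.2 ?_
    filter_upwards [key, hUfin, hsum, hnn] with ω h1 h2 h3 h4 hmem
    have h5 := h1.1 hmem
    have hfin : (∑' m, p m ω) ≠ ⊤ := (h3.trans_lt h2).ne
    obtain ⟨n, hn⟩ := (h5.eventually_gt_atTop (∑' m, p m ω).toReal).exists
    refine absurd hn (not_lt.2 ?_)
    rw [← ENNReal.ofReal_le_iff_le_toReal hfin]
    have h6 : ∀ k, (P[(s (k + 1)).indicator (1 : Ω → ℝ) | ℱ k]) ω
        = (P[(A (k + 1)).indicator (fun _ => (1 : ℝ)) | ℱ k]) ω := fun k => by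
      simp only [s, Nat.succ_ne_zero, if_false]; rfl
    simp only [Finset.sum_apply, h6]
    rw [ENNReal.ofReal_sum_of_nonneg fun i _ => h4 i]
    exact ENNReal.sum_le_tsum _
  · have hpm : ∀ m, Measurable[ℱ m] (p m) := fun m =>
      stronglyMeasurable_condExp.measurable.ennreal_ofReal
    have hpm' : ∀ m, Measurable (p m) := fun m => (hpm m).mono (ℱ.le m) le_rfl
    have hSm : Measurable fun ω => ∑' m, p m ω := Measurable.ennreal_tsum hpm'
    let B : ℕ → Set Ω := fun m => {ω | ∑ k ∈ Finset.range (m + 1), p k ω ≤ 1}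
    have hB : ∀ m, MeasurableSet[ℱ m] (B m) := by
      intro m
      refine (show Measurable[ℱ m] (fun ω => ∑ k ∈ Finset.range (m + 1), p k ω) from ?_) measurableSet_Iic
      refine Finset.measurable_fun_sum _ fun k hk => ?_
      exact (hpm k).mono (ℱ.mono (by simp at hk; omega)) le_rfl
    have hAB : ∀ m, P (A (m + 1) ∩ B m) = ∫⁻ ω in B m, p m ω ∂P := by
      intro m
      have h1 := setIntegral_condExp (ℱ.le m) (hint m) (hB m)
      rw [← ofReal_integral_eq_lintegral_ofReal integrable_condExp.integrableOn
        (ae_restrict_of_ae (hnn.mono fun ω h => h m)), h1,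
        integral_indicator_const _ (hA' m)]
      simp [measureReal_def, Measure.restrict_apply (hA' m)]
    have h1 : ∑' m, P (A (m + 1) ∩ B m) ≤ ∫⁻ ω, min (∑' m, p m ω) 1 ∂P := by
      have : ∀ m, P (A (m + 1) ∩ B m) = ∫⁻ ω, (B m).indicator (p m) ω ∂P := fun m => by
        rw [hAB, lintegral_indicator (ℱ.le m _ (hB m))]
      simp only [this]
      rw [← lintegral_tsum fun m => ((hpm' m).indicator (ℱ.le m _ (hB m))).aemeasurable]
      refine lintegral_mono fun ω => ?_
      refine le_trans (le_of_eq ?_) (aux_trunc fun m => p m ω)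
      refine tsum_congr fun m => ?_
      simp [Set.indicator_apply, B]
    have h2 : P {ω | 1 < ∑' m, p m ω} ≤ ∫⁻ ω, min (∑' m, p m ω) 1 ∂P := by
      refine le_trans (measure_mono ?_)
        ((one_mul (P {ω | 1 ≤ min (∑' m, p m ω) 1})).symm.le.trans
          (mul_meas_ge_le_lintegral (hSm.min measurable_const) 1))
      intro ω (hω : 1 < ∑' m, p m ω)
      exact le_min (le_of_lt hω) le_rfl
    have h3 : (⋃ m, A (m + 1)) ⊆ (⋃ m, A (m + 1) ∩ B m) ∪ {ω | 1 < ∑' m, p m ω} := by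
      intro ω hω
      obtain ⟨m, hm⟩ := Set.mem_iUnion.1 hω
      by_cases h : ω ∈ B m
      · exact Or.inl (Set.mem_iUnion.2 ⟨m, hm, h⟩)
      · exact Or.inr ((not_le.1 h).trans_le (ENNReal.sum_le_tsum _))
    have h4 : ∫⁻ ω, min (∑' m, p m ω) 1 ∂P ≤ ∫⁻ ω, min (U ω) 1 ∂P :=
      lintegral_mono_ae (hsum.mono fun ω h => min_le_min_right _ h)
    calc P (⋃ m, A (m + 1)) ≤ _ := measure_mono h3
      _ ≤ _ := measure_union_le _ _
      _ ≤ _ := add_le_add ((measure_iUnion_le _).trans (h1.trans h4)) (h2.trans h4)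
      _ = _ := (two_mul _).symm
end

section
/- Let 0 < t_c < ∞ and let A_2, C_1, C_2, x_ϖ, b : [0, t_c] → ℝ be continuous functions with b(t_c) > 0. Suppose t_0 ∈ [0, t_c) and y : [t_0, t_c) → (0, ∞) is differentiable with y'(t) = −(A_2(t) + C_2(t)·x_ϖ(t))·y(t)² − 2·C_1(t)·y(t) − b(t) for all t ∈ [t_0, t_c), and y(t) → 0 as t → t_c from the left. Then (t_c − t)/y(t) → 1/b(t_c) as t → t_c from the left. -/
open Filter Topology Set

/-- If `y > 0` solves `y' = −(A₂ + C₂ xϖ) y² − 2 C₁ y − b` on `[t₀, t_c)` with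
continuous coefficients on `[0, t_c]`, `b t_c > 0`, and `y(t) → 0` as `t → t_c⁻`,
then `(t_c − t)/y(t) → 1/b(t_c)` as `t → t_c⁻`. -/
theorem stmt12
    (t_c : ℝ) (htc : 0 < t_c)
    (A2 C1 C2 xϖ b : ℝ → ℝ)
    (hA2 : ContinuousOn A2 (Icc 0 t_c)) (hC1 : ContinuousOn C1 (Icc 0 t_c))
    (hC2 : ContinuousOn C2 (Icc 0 t_c)) (hxϖ : ContinuousOn xϖ (Icc 0 t_c))
    (hb : ContinuousOn b (Icc 0 t_c)) (hbtc : 0 < b t_c)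
    (t₀ : ℝ) (ht₀ : t₀ ∈ Ico 0 t_c)
    (y : ℝ → ℝ)
    (hypos : ∀ t ∈ Ico t₀ t_c, 0 < y t)
    (hyderiv : ∀ t ∈ Ico t₀ t_c,
      HasDerivWithinAt y
        (-(A2 t + C2 t * xϖ t) * y t ^ 2 - 2 * C1 t * y t - b t) (Ico t₀ t_c) t)
    (hy0 : Tendsto y (nhdsWithin t_c (Ico t₀ t_c)) (𝓝 0)) :
    Tendsto (fun t => (t_c - t) / y t) (nhdsWithin t_c (Ico t₀ t_c)) (𝓝 (1 / b t_c)) := by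
  have hlt : t₀ < t_c := ht₀.2
  rw [nhdsWithin_Ico_eq_nhdsLT hlt] at hy0 ⊢
  have hmem : ∀ᶠ t in 𝓝[<] t_c, t ∈ Ioo t₀ t_c := Ioo_mem_nhdsLT hlt
  have hc : ∀ f : ℝ → ℝ, ContinuousOn f (Icc 0 t_c) → Tendsto f (𝓝[<] t_c) (𝓝 (f t_c)) := by
    intro f hf
    have h := hf t_c (right_mem_Icc.2 htc.le)
    have h2 := h.mono Ico_subset_Icc_self
    have h3 : Tendsto f (𝓝[Ico 0 t_c] t_c) (𝓝 (f t_c)) := h2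
    rwa [nhdsWithin_Ico_eq_nhdsLT htc] at h3
  have hlim : Tendsto (fun t => -(A2 t + C2 t * xϖ t) * y t ^ 2 - 2 * C1 t * y t - b t)
      (𝓝[<] t_c) (𝓝 (-b t_c)) := by
    have h := (((((hc A2 hA2).add ((hc C2 hC2).mul (hc xϖ hxϖ))).neg).mul (hy0.pow 2)).sub
      (((hc C1 hC1).const_mul 2).mul hy0)).sub (hc b hb)
    simpa using h
  have hne : ∀ᶠ t in 𝓝[<] t_c,
      -(A2 t + C2 t * xϖ t) * y t ^ 2 - 2 * C1 t * y t - b t ≠ 0 :=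
    hlim.eventually_ne (by linarith [hbtc] : -b t_c < 0).ne
  have hdy : ∀ᶠ t in 𝓝[<] t_c, HasDerivAt y
      (-(A2 t + C2 t * xϖ t) * y t ^ 2 - 2 * C1 t * y t - b t) t := by
    filter_upwards [hmem] with t ht
    exact (hyderiv t (Ioo_subset_Ico_self ht)).hasDerivAt (Ico_mem_nhds ht.1 ht.2)
  have hdf : ∀ᶠ t in 𝓝[<] t_c, HasDerivAt (fun t => t_c - t) (-1) t :=
    Eventually.of_forall fun t => by simpa using (hasDerivAt_id t).const_sub t_c
  have hf0 : Tendsto (fun t => t_c - t) (𝓝[<] t_c) (𝓝 0) := by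
    have : Tendsto (fun t => t_c - t) (𝓝 t_c) (𝓝 (t_c - t_c)) :=
      tendsto_const_nhds.sub tendsto_id
    rw [sub_self] at this
    exact this.mono_left nhdsWithin_le_nhds
  refine HasDerivAt.lhopital_zero_nhdsLT hdf hdy hne hf0 hy0 ?_
  have h := (tendsto_const_nhds (x := (-1 : ℝ))).div hlim (by linarith [hbtc] : -b t_c < 0).ne
  rwa [neg_div_neg_eq] at h
end

section
/- Let t_1 < t_c be reals, let B_1, B_2 : [t_1, t_c) → [0, ∞) be continuous and bounded functions, and let z : [t_1, t_c) → ℝ be differentiable with z'(t) = −B_1(t)·z(t) + B_2(t) for all t ∈ [t_1, t_c) and z(t_1) > 0. Then the limit lim_{t → t_c−} z(t) exists and lies in (0, ∞). -/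
open Filter Topology Set

/-- If `z' = −B₁ z + B₂` on `[t₁, t_c)` with `B₁, B₂` continuous, nonnegative and bounded
on `[t₁, t_c)` and `z(t₁) > 0`, then `z(t)` converges, as `t → t_c⁻`, to a limit lying in
`(0, ∞)`. -/
theorem stmt13
    (t₁ t_c : ℝ) (h : t₁ < t_c)
    (B1 B2 : ℝ → ℝ)
    (hB1c : ContinuousOn B1 (Ico t₁ t_c)) (hB2c : ContinuousOn B2 (Ico t₁ t_c))
    (hB1nn : ∀ t ∈ Ico t₁ t_c, 0 ≤ B1 t) (hB2nn : ∀ t ∈ Ico t₁ t_c, 0 ≤ B2 t)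
    (hB1bd : ∃ M : ℝ, ∀ t ∈ Ico t₁ t_c, B1 t ≤ M)
    (hB2bd : ∃ M : ℝ, ∀ t ∈ Ico t₁ t_c, B2 t ≤ M)
    (z : ℝ → ℝ)
    (hz : ∀ t ∈ Ico t₁ t_c,
      HasDerivWithinAt z (-B1 t * z t + B2 t) (Ico t₁ t_c) t)
    (hz1 : 0 < z t₁) :
    ∃ l : ℝ, 0 < l ∧ Tendsto z (nhdsWithin t_c (Ico t₁ t_c)) (𝓝 l) := by
  obtain ⟨M, hM⟩ := hB1bd
  obtain ⟨N, hN⟩ := hB2bd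
  have hM0 : 0 ≤ M := (hB1nn t₁ ⟨le_rfl, h⟩).trans (hM t₁ ⟨le_rfl, h⟩)
  have hzc : ContinuousOn z (Ico t₁ t_c) := fun t ht => (hz t ht).continuousWithinAt
  have hBd : ∀ x : ℝ, HasDerivAt (fun t => -(z t₁ * Real.exp (-(M + 1) * (t - t₁))))
      ((M + 1) * (z t₁ * Real.exp (-(M + 1) * (x - t₁)))) x := by
    intro x
    have h1 : HasDerivAt (fun t : ℝ => -(M + 1) * (t - t₁)) (-(M + 1) * 1) x :=
      ((hasDerivAt_id x).sub_const t₁).const_mul _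
    have h2 := ((h1.exp).const_mul (z t₁)).neg
    exact h2.congr_deriv (by ring)
  have hlow : ∀ t ∈ Ico t₁ t_c, z t₁ * Real.exp (-(M + 1) * (t - t₁)) ≤ z t := by
    intro b hb
    have key := image_le_of_deriv_right_lt_deriv_boundary' (f := fun t => -z t)
      (f' := fun t => -(-B1 t * z t + B2 t)) (a := t₁) (b := b)
      (B := fun t => -(z t₁ * Real.exp (-(M + 1) * (t - t₁))))
      (B' := fun x => (M + 1) * (z t₁ * Real.exp (-(M + 1) * (x - t₁))))
      ((hzc.mono (fun x hx => ⟨hx.1, hx.2.trans_lt hb.2⟩)).neg)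
      (fun x hx => by
        have hx' : x ∈ Ico t₁ t_c := ⟨hx.1, hx.2.trans hb.2⟩
        refine ((hz x hx').neg).mono_of_mem_nhdsWithin ?_
        exact mem_of_superset (Ico_mem_nhdsGE hx'.2) (Ico_subset_Ico_left hx'.1))
      (by simp)
      (fun x _ => (hBd x).continuousAt.continuousWithinAt)
      (fun x _ => (hBd x).hasDerivWithinAt)
      (fun x hx hE => by
        have hx' : x ∈ Ico t₁ t_c := ⟨hx.1, hx.2.trans hb.2⟩
        have hE' : z x = z t₁ * Real.exp (-(M + 1) * (x - t₁)) := neg_injective hE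
        have hp : 0 < z x := by rw [hE']; positivity
        show -(-B1 x * z x + B2 x) < (M + 1) * (z t₁ * Real.exp (-(M + 1) * (x - t₁)))
        rw [← hE']
        nlinarith [hB2nn x hx', mul_le_mul_of_nonneg_right (hM x hx') hp.le])
      (right_mem_Icc.2 hb.1)
    exact neg_le_neg_iff.1 key
  set δ := z t₁ * Real.exp (-(M + 1) * (t_c - t₁)) with hδ
  have hδ0 : 0 < δ := by positivity
  have hlow' : ∀ t ∈ Ico t₁ t_c, δ ≤ z t := by
    intro t ht
    refine le_trans ?_ (hlow t ht)
    refine mul_le_mul_of_nonneg_left (Real.exp_le_exp.2 ?_) hz1.le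
    nlinarith [ht.2]
  have hgd : ∀ x ∈ Ioo t₁ t_c,
      HasDerivAt (fun t => z t - N * t) (-B1 x * z x + B2 x - N * 1) x := by
    intro x hx
    exact ((hz x ⟨hx.1.le, hx.2⟩).hasDerivAt (Ico_mem_nhds hx.1 hx.2)).sub
      ((hasDerivAt_id x).const_mul N)
  have hanti : AntitoneOn (fun t => z t - N * t) (Ioo t₁ t_c) := by
    refine antitoneOn_of_deriv_nonpos (convex_Ioo _ _)
      (fun x hx => (hgd x hx).continuousAt.continuousWithinAt) ?_ ?_
    · rw [interior_Ioo]
      exact fun x hx => (hgd x hx).differentiableAt.differentiableWithinAt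
    · rw [interior_Ioo]
      intro x hx
      have hx' : x ∈ Ico t₁ t_c := ⟨hx.1.le, hx.2⟩
      rw [(hgd x hx).deriv]
      nlinarith [hN x hx', mul_nonneg (hB1nn x hx') (hδ0.le.trans (hlow' x hx'))]
  have hN0 : 0 ≤ N := (hB2nn t₁ ⟨le_rfl, h⟩).trans (hN t₁ ⟨le_rfl, h⟩)
  have hlim := hanti.tendsto_nhdsWithin_Ioo_left (nonempty_Ioo.2 h) (by
    refine ⟨δ - N * t_c, ?_⟩
    rintro _ ⟨x, hx, rfl⟩
    have := hlow' x ⟨hx.1.le, hx.2⟩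
    show δ - N * t_c ≤ z x - N * x
    nlinarith [mul_le_mul_of_nonneg_left hx.2.le hN0])
  have hlin : Tendsto (fun t : ℝ => N * t) (𝓝[<] t_c) (𝓝 (N * t_c)) :=
    ((continuous_const.mul continuous_id).tendsto t_c).mono_left nhdsWithin_le_nhds
  have hzl := hlim.add hlin
  simp only [sub_add_cancel] at hzl
  rw [nhdsWithin_Ico_eq_nhdsLT h]
  refine ⟨_, lt_of_lt_of_le hδ0 (ge_of_tendsto hzl ?_), hzl⟩
  filter_upwards [Ico_mem_nhdsLT h] with t ht using hlow' t ht
end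

section
/- For each n, let η_n^−, η_n^+, η_n be real random variables defined on a common probability space (which may vary with n), and let η* be a real random variable. Assume that P{η_n^− ≤ η_n^+} → 1 as n → ∞, and that η_n^− → η* and η_n^+ → η* in distribution. Then η_n^+ − η_n^− → 0 in probability. If moreover P{η_n^− ≤ η_n ≤ η_n^+} → 1 as n → ∞, then η_n → η* in distribution and η_n − η_n^− → 0 in probability. -/
open MeasureTheory Filter Topology
open scoped ENNReal

lemma aux_int {Ω : Type*} [MeasurableSpace Ω] (P : Measure Ω) [IsProbabilityMeasure P]
    (f : BoundedContinuousFunction ℝ ℝ) (X : Ω → ℝ) (hX : Measurable X) :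
    Integrable (fun ω => f (X ω)) P :=
  Integrable.of_bound (f.continuous.measurable.comp hX).aestronglyMeasurable ‖f‖
    (ae_of_all _ fun _ => f.norm_coe_le_norm _)

lemma aux_compl (Ω : ℕ → Type*) (mΩ : ∀ n, MeasurableSpace (Ω n))
    (P : ∀ n, Measure (Ω n)) (hP : ∀ n, IsProbabilityMeasure (P n))
    (S : ∀ n, Set (Ω n)) (hS : ∀ n, MeasurableSet (S n))
    (h : Tendsto (fun n => P n (S n)) atTop (𝓝 1)) :
    Tendsto (fun n => (P n).real (S n)ᶜ) atTop (𝓝 0) := by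
  have h1 : Tendsto (fun n => (P n).real (S n)) atTop (𝓝 1) := by
    have := (ENNReal.tendsto_toReal ENNReal.one_ne_top).comp h
    simpa using! this
  have h2 := (tendsto_const_nhds (x := (1:ℝ))).sub h1
  simp only [sub_self] at h2
  refine h2.congr fun n => ?_
  rw [probReal_compl_eq_one_sub (hS n)]

lemma aux_ennreal (Ω : ℕ → Type*) (mΩ : ∀ n, MeasurableSpace (Ω n))
    (P : ∀ n, Measure (Ω n)) (hP : ∀ n, IsProbabilityMeasure (P n))
    (S : ∀ n, Set (Ω n))
    (h : Tendsto (fun n => (P n).real (S n)) atTop (𝓝 0)) :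
    Tendsto (fun n => P n (S n)) atTop (𝓝 0) := by
  have := ENNReal.tendsto_ofReal h
  simp only [ENNReal.ofReal_zero] at this
  refine this.congr fun n => ?_
  simp

/-- arctan as a bounded continuous function -/
noncomputable def auxG : BoundedContinuousFunction ℝ ℝ :=
  BoundedContinuousFunction.ofNormedAddCommGroup Real.arctan Real.continuous_arctan (Real.pi / 2)
    (fun x => by
      rw [Real.norm_eq_abs, abs_le]
      exact ⟨(Real.neg_pi_div_two_lt_arctan x).le, (Real.arctan_lt_pi_div_two x).le⟩)

lemma auxH_pos {ε : ℝ} (hε : 0 < ε) (x : ℝ) : 0 < Real.arctan (x + ε) - Real.arctan x :=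
  sub_pos.2 (Real.arctan_strictMono (by linarith))

/-- cutoff -/
noncomputable def auxPsi (ε : ℝ) (hε : 0 < ε) (k : ℕ) : BoundedContinuousFunction ℝ ℝ :=
  BoundedContinuousFunction.ofNormedAddCommGroup
    (fun x => max 0 (1 - (k : ℝ) * (Real.arctan (x + ε) - Real.arctan x)))
    (by have := Real.continuous_arctan; fun_prop) 1
    (fun x => by
      rw [Real.norm_eq_abs, abs_of_nonneg (le_max_left _ _)]
      refine max_le zero_le_one ?_
      have : 0 ≤ (k : ℝ) * (Real.arctan (x + ε) - Real.arctan x) :=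
        mul_nonneg (Nat.cast_nonneg k) (auxH_pos hε x).le
      linarith)

lemma auxG_apply (x : ℝ) : auxG x = Real.arctan x := rfl

lemma auxPsi_apply (ε : ℝ) (hε : 0 < ε) (k : ℕ) (x : ℝ) :
    auxPsi ε hε k x = max 0 (1 - (k : ℝ) * (Real.arctan (x + ε) - Real.arctan x)) := rfl

lemma auxPsi_tendsto {Ωs : Type*} [MeasurableSpace Ωs] (Ps : Measure Ωs) [IsProbabilityMeasure Ps]
    (ηs : Ωs → ℝ) (hmeass : Measurable ηs) (ε : ℝ) (hε : 0 < ε) :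
    Tendsto (fun k : ℕ => ∫ ω, auxPsi ε hε k (ηs ω) ∂Ps) atTop (𝓝 0) := by
  have h0 : (0 : ℝ) = ∫ ω, (0 : ℝ) ∂Ps := by simp
  rw [h0]
  refine tendsto_integral_of_dominated_convergence (fun _ => (1 : ℝ))
    (fun k => (aux_int Ps (auxPsi ε hε k) ηs hmeass).aestronglyMeasurable)
    (integrable_const _) ?_ ?_
  · intro k
    refine ae_of_all _ fun ω => ?_
    rw [auxPsi_apply, Real.norm_eq_abs, abs_of_nonneg (le_max_left _ _)]
    refine max_le zero_le_one ?_
    have : 0 ≤ (k : ℝ) * (Real.arctan (ηs ω + ε) - Real.arctan (ηs ω)) :=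
      mul_nonneg (Nat.cast_nonneg k) (auxH_pos hε _).le
    linarith
  · refine ae_of_all _ fun ω => ?_
    have hp := auxH_pos hε (ηs ω)
    obtain ⟨K, hK⟩ := exists_nat_gt (1 / (Real.arctan (ηs ω + ε) - Real.arctan (ηs ω)))
    refine tendsto_const_nhds.congr' ?_
    filter_upwards [eventually_ge_atTop K] with k hk
    rw [auxPsi_apply, max_eq_left]
    have hk' : (K : ℝ) ≤ k := by exact_mod_cast hk
    rw [div_lt_iff₀ hp] at hK
    nlinarith

lemma aux_main
    (Ω : ℕ → Type*) (mΩ : ∀ n, MeasurableSpace (Ω n))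
    (P : ∀ n, Measure (Ω n)) (hP : ∀ n, IsProbabilityMeasure (P n))
    (Ωs : Type*) [MeasurableSpace Ωs] (Ps : Measure Ωs) [IsProbabilityMeasure Ps]
    (ηm ηp : ∀ n, Ω n → ℝ) (ηs : Ωs → ℝ)
    (hmeasm : ∀ n, Measurable (ηm n)) (hmeasp : ∀ n, Measurable (ηp n))
    (hmeass : Measurable ηs)
    (hle : Tendsto (fun n => P n {ω | ηm n ω ≤ ηp n ω}) atTop (𝓝 1))
    (hdm : ∀ f : BoundedContinuousFunction ℝ ℝ,
      Tendsto (fun n => ∫ ω, f (ηm n ω) ∂P n) atTop (𝓝 (∫ ω, f (ηs ω) ∂Ps)))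
    (hdp : ∀ f : BoundedContinuousFunction ℝ ℝ,
      Tendsto (fun n => ∫ ω, f (ηp n ω) ∂P n) atTop (𝓝 (∫ ω, f (ηs ω) ∂Ps)))
    (ε : ℝ) (hε : 0 < ε) :
    Tendsto (fun n => (P n).real {ω | ε < |ηp n ω - ηm n ω|}) atTop (𝓝 0) := by
  have hSm : ∀ n, MeasurableSet {ω | ηm n ω ≤ ηp n ω} :=
    fun n => measurableSet_le (hmeasm n) (hmeasp n)
  have hB := aux_compl Ω mΩ P hP _ hSm hle
  have key : ∀ (k n : ℕ), (P n).real {ω | ε < |ηp n ω - ηm n ω|} ≤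
      (1 + k * Real.pi) * (P n).real {ω | ηm n ω ≤ ηp n ω}ᶜ
      + k * ((∫ ω, auxG (ηp n ω) ∂P n) - ∫ ω, auxG (ηm n ω) ∂P n)
      + ∫ ω, auxPsi ε hε k (ηm n ω) ∂P n := by
    intro k n
    have := hP n
    have hA : MeasurableSet {ω | ε < |ηp n ω - ηm n ω|} :=
      measurableSet_lt measurable_const
        (continuous_abs.measurable.comp ((hmeasp n).sub (hmeasm n)))
    have i1 := aux_int (P n) auxG _ (hmeasp n)
    have i2 := aux_int (P n) auxG _ (hmeasm n)
    have i3 := aux_int (P n) (auxPsi ε hε k) _ (hmeasm n)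
    have i4 : Integrable ({ω | ηm n ω ≤ ηp n ω}ᶜ.indicator (1 : Ω n → ℝ)) (P n) :=
      (integrable_const (1 : ℝ)).indicator (hSm n).compl
    have i5 : Integrable ({ω | ε < |ηp n ω - ηm n ω|}.indicator (1 : Ω n → ℝ)) (P n) :=
      (integrable_const (1 : ℝ)).indicator hA
    have i6 : Integrable (fun ω => (k : ℝ) * (auxG (ηp n ω) - auxG (ηm n ω))) (P n) :=
      (i1.sub i2).const_mul _
    have i7 : Integrable (fun ω => (1 + (k : ℝ) * Real.pi) *
        {ω | ηm n ω ≤ ηp n ω}ᶜ.indicator (1 : Ω n → ℝ) ω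
        + (k : ℝ) * (auxG (ηp n ω) - auxG (ηm n ω))) (P n) :=
      (i4.const_mul _).add i6
    rw [← integral_indicator_one hA, ← integral_indicator_one (hSm n).compl,
      ← integral_sub i1 i2, ← integral_const_mul, ← integral_const_mul,
      ← integral_add (i4.const_mul _) i6,
      ← integral_add i7 i3]
    refine integral_mono i5 (i7.add i3) ?_
    intro ω
    have hk : (0 : ℝ) ≤ k := Nat.cast_nonneg k
    have hpsi0 : 0 ≤ auxPsi ε hε k (ηm n ω) := le_max_left _ _
    have hpsi1 : 1 - (k : ℝ) * (Real.arctan (ηm n ω + ε) - Real.arctan (ηm n ω))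
      ≤ auxPsi ε hε k (ηm n ω) := le_max_right _ _
    have b1 := Real.neg_pi_div_two_lt_arctan (ηp n ω)
    have b2 := Real.arctan_lt_pi_div_two (ηm n ω)
    show _ ≤ (1 + k * Real.pi) * _ + k * (auxG (ηp n ω) - auxG (ηm n ω)) + _
    simp only [auxG_apply]
    by_cases hc : ηm n ω ≤ ηp n ω
    · rw [Set.indicator_of_notMem (s := {ω | ηm n ω ≤ ηp n ω}ᶜ) (by simpa using hc)]
      have hmono := Real.arctan_strictMono.monotone hc
      by_cases ha : ε < |ηp n ω - ηm n ω|
      · rw [Set.indicator_of_mem (by exact ha)]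
        rw [abs_of_nonneg (by linarith)] at ha
        have := Real.arctan_strictMono.monotone (show ηm n ω + ε ≤ ηp n ω by linarith)
        have := mul_le_mul_of_nonneg_left this hk
        simp only [Pi.one_apply]
        linarith
      · rw [Set.indicator_of_notMem (by exact ha)]
        have := mul_nonneg hk (sub_nonneg.2 hmono)
        linarith
    · rw [Set.indicator_of_mem (s := {ω | ηm n ω ≤ ηp n ω}ᶜ) (by simpa using hc)]
      have h1 : {ω | ε < |ηp n ω - ηm n ω|}.indicator (1 : Ω n → ℝ) ω ≤ 1 :=
        Set.indicator_le_self' (fun _ _ => zero_le_one) ω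
      have := mul_nonneg hk
        (show 0 ≤ Real.pi + (Real.arctan (ηp n ω) - Real.arctan (ηm n ω)) by linarith)
      simp only [Pi.one_apply]
      linarith
  rw [Metric.tendsto_atTop']
  intro c hc
  obtain ⟨k, hk⟩ := ((auxPsi_tendsto Ps ηs hmeass ε hε).eventually (gt_mem_nhds hc)).exists
  have hlim := ((hB.const_mul (1 + (k : ℝ) * Real.pi)).add
    (((hdp auxG).sub (hdm auxG)).const_mul (k : ℝ))).add (hdm (auxPsi ε hε k))
  simp only [sub_self, mul_zero, zero_add] at hlim
  obtain ⟨N, hN⟩ := eventually_atTop.1 (hlim.eventually (gt_mem_nhds hk))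
  refine ⟨N, fun n hn => ?_⟩
  rw [Real.dist_eq, sub_zero, abs_of_nonneg measureReal_nonneg]
  exact (key k n).trans_lt (hN n hn.le)

lemma aux_slutsky
    (Ω : ℕ → Type*) (mΩ : ∀ n, MeasurableSpace (Ω n))
    (P : ∀ n, Measure (Ω n)) (hP : ∀ n, IsProbabilityMeasure (P n))
    (Ωs : Type*) [MeasurableSpace Ωs] (Ps : Measure Ωs) [IsProbabilityMeasure Ps]
    (X Y : ∀ n, Ω n → ℝ) (ηs : Ωs → ℝ)
    (hX : ∀ n, Measurable (X n)) (hY : ∀ n, Measurable (Y n))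
    (hmeass : Measurable ηs)
    (hd : ∀ f : BoundedContinuousFunction ℝ ℝ,
      Tendsto (fun n => ∫ ω, f (X n ω) ∂P n) atTop (𝓝 (∫ ω, f (ηs ω) ∂Ps)))
    (hp : ∀ ε : ℝ, 0 < ε →
      Tendsto (fun n => (P n).real {ω | ε < |Y n ω - X n ω|}) atTop (𝓝 0))
    (f : BoundedContinuousFunction ℝ ℝ) :
    Tendsto (fun n => ∫ ω, f (Y n ω) ∂P n) atTop (𝓝 (∫ ω, f (ηs ω) ∂Ps)) := by
  let μs : ℕ → ProbabilityMeasure ℝ := fun n =>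
    ⟨(P n).map (Y n), Measure.isProbabilityMeasure_map (hY n).aemeasurable⟩
  let μ : ProbabilityMeasure ℝ :=
    ⟨Ps.map ηs, Measure.isProbabilityMeasure_map hmeass.aemeasurable⟩
  have hm : Tendsto μs atTop (𝓝 μ) := by
    rw [tendsto_iff_forall_lipschitz_integral_tendsto]
    rintro F ⟨M, hM⟩ ⟨L, hL⟩
    have hFc := hL.continuous
    let F' : BoundedContinuousFunction ℝ ℝ := ⟨⟨F, hFc⟩, M, hM⟩
    have e1 : ∀ n, ∫ x, F x ∂(μs n : Measure ℝ) = ∫ ω, F' (Y n ω) ∂P n := fun n =>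
      integral_map (hY n).aemeasurable hFc.aestronglyMeasurable
    have e2 : ∫ x, F x ∂(μ : Measure ℝ) = ∫ ω, F' (ηs ω) ∂Ps :=
      integral_map hmeass.aemeasurable hFc.aestronglyMeasurable
    simp only [e1, e2]
    have hM0 : 0 ≤ M := dist_nonneg.trans (hM 0 0)
    have hdiff : Tendsto (fun n => (∫ ω, F' (Y n ω) ∂P n) - ∫ ω, F' (X n ω) ∂P n)
        atTop (𝓝 0) := by
      have key : ∀ (ε : ℝ), 0 < ε → ∀ n, ‖(∫ ω, F' (Y n ω) ∂P n) - ∫ ω, F' (X n ω) ∂P n‖ ≤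
          L * ε + M * (P n).real {ω | ε < |Y n ω - X n ω|} := by
        intro ε hε n
        have := hP n
        have hA : MeasurableSet {ω | ε < |Y n ω - X n ω|} :=
          measurableSet_lt measurable_const
            (continuous_abs.measurable.comp ((hY n).sub (hX n)))
        have i1 := aux_int (P n) F' _ (hY n)
        have i2 := aux_int (P n) F' _ (hX n)
        have i5 : Integrable ({ω | ε < |Y n ω - X n ω|}.indicator (1 : Ω n → ℝ)) (P n) :=
          (integrable_const (1 : ℝ)).indicator hA
        have e : L * ε + M * (P n).real {ω | ε < |Y n ω - X n ω|} =
            ∫ ω, (L * ε + M * {ω | ε < |Y n ω - X n ω|}.indicator (1 : Ω n → ℝ) ω) ∂P n := by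
          rw [integral_add (integrable_const _) (i5.const_mul _), integral_const_mul M,
            integral_indicator_one hA]
          simp
        rw [← integral_sub i1 i2, e]
        refine norm_integral_le_of_norm_le ((integrable_const _).add (i5.const_mul _)) ?_
        refine ae_of_all _ fun ω => ?_
        rw [← dist_eq_norm]
        have hLε : 0 ≤ (L : ℝ) * ε := by positivity
        by_cases ha : ε < |Y n ω - X n ω|
        · rw [Set.indicator_of_mem (by exact ha)]
          have : dist (F' (Y n ω)) (F' (X n ω)) ≤ M := hM _ _
          simp only [Pi.one_apply]
          linarith
        · rw [Set.indicator_of_notMem (by exact ha)]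
          have h1 : dist (F' (Y n ω)) (F' (X n ω)) ≤ L * dist (Y n ω) (X n ω) :=
            hL.dist_le_mul _ _
          have h2 := mul_le_mul_of_nonneg_left (not_lt.1 ha) L.coe_nonneg
          rw [Real.dist_eq (Y n ω)] at h1
          linarith
      rw [Metric.tendsto_atTop']
      intro c hc
      have hε : 0 < c / (2 * (L + 1)) := by positivity
      have hLε : L * (c / (2 * (L + 1))) < c := by
        have : (L : ℝ) * (c / (2 * (L + 1))) = c * (L / (2 * (L + 1))) := by ring
        rw [this]
        have : (L : ℝ) / (2 * (L + 1)) < 1 := by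
          rw [div_lt_one (by positivity)]
          have := L.coe_nonneg
          linarith
        nlinarith
      have hlim := ((hp _ hε).const_mul M).const_add (L * (c / (2 * (L + 1))))
      simp only [mul_zero, add_zero] at hlim
      obtain ⟨N, hN⟩ := eventually_atTop.1 (hlim.eventually (gt_mem_nhds hLε))
      refine ⟨N, fun n hn => ?_⟩
      rw [dist_zero_right]
      exact (key _ hε n).trans_lt (hN n hn.le)
    have := hdiff.add (hd F')
    simpa using this
  rw [ProbabilityMeasure.tendsto_iff_forall_integral_tendsto] at hm
  have h := hm f
  have e1 : ∀ n, ∫ x, f x ∂(μs n : Measure ℝ) = ∫ ω, f (Y n ω) ∂P n := fun n =>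
    integral_map (hY n).aemeasurable f.continuous.aestronglyMeasurable
  have e2 : ∫ x, f x ∂(μ : Measure ℝ) = ∫ ω, f (ηs ω) ∂Ps :=
    integral_map hmeass.aemeasurable f.continuous.aestronglyMeasurable
  simpa only [e1, e2] using h

/-- Sandwich lemma for convergence in distribution: if `ηₙ⁻ ≤ ηₙ⁺` whp and both converge
in distribution to `η*`, then `ηₙ⁺ − ηₙ⁻ → 0` in probability; and if moreover
`ηₙ⁻ ≤ ηₙ ≤ ηₙ⁺` whp, then `ηₙ → η*` in distribution and `ηₙ − ηₙ⁻ → 0` in probability.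
Convergence in distribution is stated via integrals of bounded continuous functions. -/
theorem stmt16
    (Ω : ℕ → Type*) (mΩ : ∀ n, MeasurableSpace (Ω n))
    (P : ∀ n, Measure (Ω n)) (hP : ∀ n, IsProbabilityMeasure (P n))
    (Ωs : Type*) [MeasurableSpace Ωs] (Ps : Measure Ωs) [IsProbabilityMeasure Ps]
    (ηm ηp η : ∀ n, Ω n → ℝ) (ηs : Ωs → ℝ)
    (hmeasm : ∀ n, Measurable (ηm n)) (hmeasp : ∀ n, Measurable (ηp n))
    (hmeasn : ∀ n, Measurable (η n)) (hmeass : Measurable ηs)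
    (hle : Tendsto (fun n => P n {ω | ηm n ω ≤ ηp n ω}) atTop (𝓝 1))
    (hdm : ∀ f : BoundedContinuousFunction ℝ ℝ,
      Tendsto (fun n => ∫ ω, f (ηm n ω) ∂P n) atTop (𝓝 (∫ ω, f (ηs ω) ∂Ps)))
    (hdp : ∀ f : BoundedContinuousFunction ℝ ℝ,
      Tendsto (fun n => ∫ ω, f (ηp n ω) ∂P n) atTop (𝓝 (∫ ω, f (ηs ω) ∂Ps))) :
    (∀ ε : ℝ, 0 < ε →
      Tendsto (fun n => P n {ω | ε < |ηp n ω - ηm n ω|}) atTop (𝓝 0)) ∧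
    ((Tendsto (fun n => P n {ω | ηm n ω ≤ η n ω ∧ η n ω ≤ ηp n ω}) atTop (𝓝 1)) →
      ((∀ f : BoundedContinuousFunction ℝ ℝ,
          Tendsto (fun n => ∫ ω, f (η n ω) ∂P n) atTop (𝓝 (∫ ω, f (ηs ω) ∂Ps))) ∧
        (∀ ε : ℝ, 0 < ε →
          Tendsto (fun n => P n {ω | ε < |η n ω - ηm n ω|}) atTop (𝓝 0)))) := by
  have h1 := aux_main Ω mΩ P hP Ωs Ps ηm ηp ηs hmeasm hmeasp hmeass hle hdm hdp
  refine ⟨fun ε hε => aux_ennreal Ω mΩ P hP _ (h1 ε hε), fun hs => ?_⟩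
  have hSm : ∀ n, MeasurableSet {ω | ηm n ω ≤ η n ω ∧ η n ω ≤ ηp n ω} := fun n =>
    (measurableSet_le (hmeasm n) (hmeasn n)).inter (measurableSet_le (hmeasn n) (hmeasp n))
  have hB := aux_compl Ω mΩ P hP _ hSm hs
  have h2 : ∀ ε : ℝ, 0 < ε →
      Tendsto (fun n => (P n).real {ω | ε < |η n ω - ηm n ω|}) atTop (𝓝 0) := by
    intro ε hε
    have hsum := hB.add (h1 ε hε)
    rw [add_zero] at hsum
    refine squeeze_zero (fun _ => measureReal_nonneg) (fun n => ?_) hsum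
    have := hP n
    refine (measureReal_mono ?_).trans (measureReal_union_le _ _)
    intro ω hω
    by_cases hc : ηm n ω ≤ η n ω ∧ η n ω ≤ ηp n ω
    · right
      have hω' : ε < |η n ω - ηm n ω| := hω
      rw [abs_of_nonneg (by linarith [hc.1])] at hω'
      show ε < |ηp n ω - ηm n ω|
      rw [abs_of_nonneg (by linarith [hc.1, hc.2])]
      linarith [hc.2]
    · left
      exact hc
  exact ⟨aux_slutsky Ω mΩ P hP Ωs Ps ηm η ηs hmeasm hmeasn hmeass hdm h2,
    fun ε hε => aux_ennreal Ω mΩ P hP _ (h2 ε hε)⟩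
end
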